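/- arXiv:1706.03571 — 3 statements merged into one kernel-verified Lean document; each statement's English description precedes it below -/
import Mathlib

section
/- Let L, L' ⊆ ℝ^d be linear subspaces. The set of rotations ϑ ∈ SO(d) for which L and ϑL' are in special position (i.e., not in general position) has ν-measure zero, where ν is the Haar probability measure on SO(d). -/
open MeasureTheory Set
open scoped ENNReal RealInnerProductSpace Pointwise

noncomputable section

/-- Abbreviation for Euclidean space `ℝ^d`. -/
abbrev Euc (d : ℕ) := EuclideanSpace ℝ (Fin d)

/-- The rotation group `SO(d)`, as a subgroup of the orthogonal group. -/
def SOG (d : ℕ) : Subgroup (Matrix.orthogonalGroup (Fin d) ℝ) where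
  carrier := {A | (A : Matrix (Fin d) (Fin d) ℝ).det = 1}
  one_mem' := Matrix.det_one
  mul_mem' := by
    intro a b ha hb
    simp only [Set.mem_setOf_eq] at *
    rw [show ((a * b : Matrix.orthogonalGroup (Fin d) ℝ) : Matrix (Fin d) (Fin d) ℝ)
        = (a : Matrix (Fin d) (Fin d) ℝ) * (b : Matrix (Fin d) (Fin d) ℝ) from rfl,
      Matrix.det_mul, ha, hb, mul_one]
  inv_mem' := by
    intro a ha
    simp only [Set.mem_setOf_eq] at *
    rw [show ((a⁻¹ : Matrix.orthogonalGroup (Fin d) ℝ) : Matrix (Fin d) (Fin d) ℝ)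
        = star (a : Matrix (Fin d) (Fin d) ℝ) from rfl]
    rw [Matrix.star_eq_conjTranspose, Matrix.det_conjTranspose, ha, star_one]

instance (d : ℕ) : MeasurableSpace (SOG d) := borel _

/-- A rotation `ϑ ∈ SO(d)`, as a linear map on `ℝ^d`. -/
def rotLin {d : ℕ} (ϑ : SOG d) : Euc d →ₗ[ℝ] Euc d :=
  ((EuclideanSpace.equiv (Fin d) ℝ).symm.toLinearEquiv.toLinearMap.comp
    (Matrix.mulVecLin (ϑ : Matrix (Fin d) (Fin d) ℝ))).comp
    (EuclideanSpace.equiv (Fin d) ℝ).toLinearEquiv.toLinearMap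

/-- The action of a rotation `ϑ ∈ SO(d)` on `ℝ^d`. -/
def rot {d : ℕ} (ϑ : SOG d) : Euc d → Euc d := rotLin ϑ

variable {d : ℕ}

/-- The standard Gaussian probability measure `γ_d` on `ℝ^d`. -/
def stdGauss (d : ℕ) : Measure (Euc d) :=
  volume.withDensity fun x =>
    ENNReal.ofReal ((2 * Real.pi) ^ (-(d : ℝ) / 2) * Real.exp (-‖x‖ ^ 2 / 2))

/-- The standard Gaussian measure `γ_L` of a linear subspace `L` of `ℝ^d`, viewed as a measure
on `ℝ^d` concentrated on `L`. -/
def gauss (L : Submodule ℝ (Euc d)) : Measure (Euc d) :=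
  Measure.map (Subtype.val) <|
    (volume : Measure L).withDensity fun x =>
      ENNReal.ofReal ((2 * Real.pi) ^ (-(Module.finrank ℝ L : ℝ) / 2) *
        Real.exp (-‖(x : Euc d)‖ ^ 2 / 2))

/-- A set is conic if it is stable under multiplication by positive scalars. -/
def IsConic (A : Set (Euc d)) : Prop := ∀ a ∈ A, ∀ r : ℝ, 0 < r → r • a ∈ A

/-- A polyhedral (convex) cone: an intersection of finitely many closed halfspaces bounded by
linear hyperplanes (the empty intersection being all of `ℝ^d`). -/
def IsPolyCone (C : Set (Euc d)) : Prop :=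
  ∃ U : Finset (Euc d), C = ⋂ u ∈ U, {x | ⟪u, x⟫ ≤ 0}

/-- `F` is a face of the convex set `C`: a nonempty convex extreme subset. -/
def IsFace (C F : Set (Euc d)) : Prop := IsExtreme ℝ C F ∧ Convex ℝ F ∧ F.Nonempty

/-- The linear hull `L(F)` of a set `F`. -/
def linHull (F : Set (Euc d)) : Submodule ℝ (Euc d) := Submodule.span ℝ F

/-- The dimension of a face (or cone) `F`, i.e. the dimension of its linear hull. -/
def dimS (F : Set (Euc d)) : ℕ := Module.finrank ℝ (linHull F)

/-- `F` is a `k`-dimensional face of `C`. -/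
def IsFaceDim (C F : Set (Euc d)) (k : ℕ) : Prop := IsFace C F ∧ dimS F = k

/-- The normal cone `N(C,F)` of the cone `C` at its face `F`. -/
def normalCone (C F : Set (Euc d)) : Set (Euc d) :=
  {u | (∀ y ∈ C, ⟪u, y⟫ ≤ 0) ∧ ∀ x ∈ F, ⟪u, x⟫ = 0}

/-- The conic curvature measure `Φ_k(C, A)` of a polyhedral cone `C`, evaluated at `A`:
`Φ_k(C,A) = ∑_{F ∈ 𝓕_k(C)} γ_{L(F)}(F ∩ A) ⬝ γ_{L(F)^⊥}(N(C,F))`. -/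
def Phi (k : ℕ) (C A : Set (Euc d)) : ℝ≥0∞ :=
  ∑' F : {F : Set (Euc d) // IsFaceDim C F k},
    gauss (linHull F.1) (F.1 ∩ A) * gauss (linHull F.1)ᗮ (normalCone C F.1)

/-- The conic intrinsic volume `V_k(C) = ∑_{F ∈ 𝓕_k(C)} γ_d(F + N(C,F))`. -/
def cV (k : ℕ) (C : Set (Euc d)) : ℝ≥0∞ :=
  ∑' F : {F : Set (Euc d) // IsFaceDim C F k},
    stdGauss d (F.1 + normalCone C F.1)

/-- The localization `φ_F(C,A) = γ_d((A ∩ F) + N(C,F))` of `v_F(C)`. -/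
def phiLoc (C F A : Set (Euc d)) : ℝ≥0∞ := stdGauss d ((A ∩ F) + normalCone C F)

/-- `C` is (the underlying set of) a linear subspace of `ℝ^d`. -/
def IsLinSubspace (C : Set (Euc d)) : Prop := ∃ L : Submodule ℝ (Euc d), (L : Set (Euc d)) = C

/-- Two polyhedral cones intersect transversely: `dim (F ∩ G) = dim F + dim G − d` and the
relative interiors meet. -/
def Transverse (F G : Set (Euc d)) : Prop :=
  (dimS (F ∩ G) : ℤ) = (dimS F : ℤ) + (dimS G : ℤ) - d ∧
    (intrinsicInterior ℝ F ∩ intrinsicInterior ℝ G).Nonempty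

/-- The volume of the parallelepiped spanned by the union of orthonormal bases of `L₁` and `L₂`
(the square root of the Gram determinant of the combined family). -/
def gramVol (L₁ L₂ : Submodule ℝ (Euc d)) : ℝ :=
  Real.sqrt (Matrix.det (Matrix.of fun i j :
      Fin (Module.finrank ℝ L₁) ⊕ Fin (Module.finrank ℝ L₂) =>
    ⟪Sum.elim (fun a => ((stdOrthonormalBasis ℝ L₁) a : Euc d))
        (fun b => ((stdOrthonormalBasis ℝ L₂) b : Euc d)) i,
      Sum.elim (fun a => ((stdOrthonormalBasis ℝ L₁) a : Euc d))
        (fun b => ((stdOrthonormalBasis ℝ L₂) b : Euc d)) j⟫))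

/-- The generalized sine function `[L₁, L₂]` of two subspaces. -/
def genSine (L₁ L₂ : Submodule ℝ (Euc d)) : ℝ :=
  if Module.finrank ℝ L₁ + Module.finrank ℝ L₂ ≤ d then gramVol L₁ L₂ else gramVol L₁ᗮ L₂ᗮ

/-- The generalized sine function `[C, D] = [L(C), L(D)]` of two cones. -/
def genSineC (C D : Set (Euc d)) : ℝ := genSine (linHull C) (linHull D)

/-- Spherical Lebesgue measure `σ_{d-1}` on the unit sphere of `ℝ^d`. -/
def sphLebesgue (d : ℕ) : Measure (Metric.sphere (0 : Euc d) 1) :=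
  (volume : Measure (Euc d)).toSphere

/-- The normalized spherical Lebesgue measure `σ = σ_{d-1}/ω_d` on the unit sphere. -/
def sphNormalized (d : ℕ) : Measure (Metric.sphere (0 : Euc d) 1) :=
  (sphLebesgue d Set.univ)⁻¹ • sphLebesgue d

/-- The Schläfli cones induced by the hyperplanes `(u i)^⊥`, `i = 1, …, n`: the closures of the
connected components of the complement of the union of the hyperplanes. -/
def schlafliCones {n : ℕ} (u : Fin n → Euc d) : Set (Set (Euc d)) :=
  {C | ∃ x : Euc d, (∀ i, ⟪u i, x⟫ ≠ 0) ∧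
    C = closure (connectedComponentIn {y : Euc d | ∀ i, ⟪u i, y⟫ ≠ 0} x)}

/-- `C(n,d) = 2 ∑_{r=0}^{d-1} binom(n-1, r)`, the number of Schläfli cones induced by `n`
hyperplanes in general position. -/
def schlafliCount (n d : ℕ) : ℕ := 2 * ∑ r ∈ Finset.range d, (n - 1).choose r

/-- The joint distribution `σ^n` of the unit normal vectors of `n` independent isotropic random
hyperplanes. -/
def sphPi (d n : ℕ) : Measure (Fin n → Metric.sphere (0 : Euc d) 1) :=
  Measure.pi fun _ => sphNormalized d

end

open scoped ContDiff

/-- The zero set of a real analytic function that does not vanish identically is null. -/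
theorem addHaar_zeros_of_contDiff_omega {E : Type*} [NormedAddCommGroup E] [NormedSpace ℝ E]
    [FiniteDimensional ℝ E] [MeasurableSpace E] [BorelSpace E] (μ : Measure E)
    [μ.IsAddHaarMeasure] {f : E → ℝ} (hf : ContDiff ℝ ω f) {a : E} (ha : f a ≠ 0) :
    μ {x | f x = 0} = 0 := by
  set Z : Set E := {x | f (x + a) = 0} with hZ
  have hcont : Continuous fun x => f (x + a) := hf.continuous.comp (by fun_prop)
  have hZm : MeasurableSet Z := (isClosed_singleton.preimage hcont).measurableSet
  have hline (x : E) : volume {t : ℝ | t • x ∈ Z} = 0 := by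
    have hg : AnalyticOnNhd ℝ (fun t : ℝ => f (t • x + a)) univ := by
      rw [← contDiff_omega_iff_analyticOnNhd]
      exact hf.comp (by fun_prop)
    have h := hg.preimage_zero_mem_codiscrete (x := 0) (by simpa using ha)
    have h' := ae_restrict_le_codiscreteWithin (μ := volume) MeasurableSet.univ h
    rw [Measure.restrict_univ, mem_ae_iff] at h'
    convert h' using 2
    ext t
    simp [hZ]
  have hprod : ((volume : Measure ℝ).prod μ) {p : ℝ × E | p.1 • p.2 ∈ Z} = 0 := by
    have hm : MeasurableSet {p : E × ℝ | p.2 • p.1 ∈ Z} :=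
      (by fun_prop : Measurable fun p : E × ℝ => p.2 • p.1) hZm
    have hm' : MeasurableSet {p : ℝ × E | p.1 • p.2 ∈ Z} :=
      (by fun_prop : Measurable fun p : ℝ × E => p.1 • p.2) hZm
    rw [← Measure.prod_swap, Measure.map_apply measurable_swap hm']
    exact (Measure.measure_prod_null hm).2 (Filter.Eventually.of_forall hline)
  have hae := Measure.measure_ae_null_of_prod_null hprod
  obtain ⟨t, ht, ht0⟩ :=
    (hae.and (measure_eq_zero_iff_ae_notMem.1 (measure_singleton (0 : ℝ)))).exists
  have hZ0 : μ Z = 0 := by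
    have h := Measure.addHaar_preimage_smul μ (r := t) ht0 Z
    have h' : μ ((fun x => t • x) ⁻¹' Z) = 0 := ht
    simpa [h', show t ≠ 0 from ht0] using h.symm
  rw [← measure_preimage_add_right μ a]
  exact hZ0

/-- If the dimension of `M ∩ C₀⁻¹ L` is `s`, then there is a determinantal inequation satisfied by
`C₀` which forces `M ∩ C⁻¹ L` to have dimension at most `s`. -/
theorem exists_det_ne_zero_finrank_le {R V : Type*} [AddCommGroup V] [Module ℝ V]
    [FiniteDimensional ℝ V] [AddCommGroup R] [Module ℝ R] (Φ : R →ₗ[ℝ] V →ₗ[ℝ] V)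
    (L M : Submodule ℝ V) (c : R) :
    ∃ (n : ℕ) (Λ : R →ₗ[ℝ] Matrix (Fin n) (Fin n) ℝ), (Λ c).det ≠ 0 ∧
      ∀ x, (Λ x).det ≠ 0 → Module.finrank ℝ ↥(M ⊓ L.comap (Φ x)) ≤
        Module.finrank ℝ ↥(M ⊓ L.comap (Φ c)) := by
  obtain ⟨W, hW, hWM⟩ : ∃ W, Disjoint W (M ⊓ L.comap (Φ c)) ∧ W ⊔ (M ⊓ L.comap (Φ c)) = M := by
    obtain ⟨W, h1, h2⟩ := exists_isCompl (M ⊓ L.comap (Φ c))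
    refine ⟨W ⊓ M, h1.symm.mono_left inf_le_left, ?_⟩
    rw [sup_comm, ← sup_inf_assoc_of_le _ inf_le_left, h2.eq_top, top_inf_eq]
  have hle : W ≤ M := hWM ▸ le_sup_left
  have hinj : LinearMap.ker ((L.mkQ ∘ₗ Φ c) ∘ₗ W.subtype) = ⊥ := by
    rw [Submodule.eq_bot_iff]
    intro w hw
    have : (w : V) ∈ M ⊓ L.comap (Φ c) := ⟨hle w.2, by simpa using hw⟩
    exact Subtype.ext (Submodule.disjoint_def.1 hW _ w.2 this)
  obtain ⟨S, hS⟩ := LinearMap.exists_leftInverse_of_injective _ hinj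
  let b := Module.finBasis ℝ W
  let Λ : R →ₗ[ℝ] Matrix (Fin (Module.finrank ℝ W)) (Fin (Module.finrank ℝ W)) ℝ :=
    (LinearMap.toMatrix b b).toLinearMap ∘ₗ (LinearMap.llcomp ℝ W V W (S ∘ₗ L.mkQ)) ∘ₗ
      (LinearMap.lcomp ℝ V W.subtype) ∘ₗ Φ
  have hΛ (x : R) : (Λ x).det = LinearMap.det (S ∘ₗ (L.mkQ ∘ₗ Φ x) ∘ₗ W.subtype) := by
    rw [← LinearMap.det_toMatrix b]
    rfl
  refine ⟨_, Λ, by rw [hΛ, hS]; simp, fun x hx => ?_⟩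
  rw [hΛ] at hx
  have hdisj : Disjoint W (M ⊓ L.comap (Φ x)) := by
    rw [Submodule.disjoint_def]
    intro w hw hw'
    by_contra hw0
    refine hx (LinearMap.det_eq_zero_iff_ker_ne_bot.2 fun h => hw0 ?_)
    have h0 : Submodule.Quotient.mk (p := L) (Φ x w) = 0 := (Submodule.Quotient.mk_eq_zero L).2 hw'.2
    have : (⟨w, hw⟩ : W) ∈ LinearMap.ker (S ∘ₗ (L.mkQ ∘ₗ Φ x) ∘ₗ W.subtype) := by
      simp [h0]
    simpa [h] using this
  have e1 := Submodule.finrank_sup_add_finrank_inf_eq W (M ⊓ L.comap (Φ c))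
  have e2 := Submodule.finrank_sup_add_finrank_inf_eq W (M ⊓ L.comap (Φ x))
  rw [hW.eq_bot, hWM] at e1
  rw [hdisj.eq_bot] at e2
  have e3 := Submodule.finrank_mono (sup_le hle (inf_le_left : M ⊓ L.comap (Φ x) ≤ M))
  rw [finrank_bot] at e1 e2
  omega

namespace Matrix

variable {n : Type*}

/-- The generator `x yᵀ - y xᵀ` of the rotations in the plane spanned by `x` and `y`. -/
def planeSkew (x y : n → ℝ) : Matrix n n ℝ := vecMulVec x y - vecMulVec y x

theorem transpose_planeSkew (x y : n → ℝ) : (planeSkew x y)ᵀ = -planeSkew x y := by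
  simp [planeSkew, transpose_vecMulVec]

theorem planeSkew_mulVec [Fintype n] (x y v : n → ℝ) :
    planeSkew x y *ᵥ v = (y ⬝ᵥ v) • x - (x ⬝ᵥ v) • y := by
  simp [planeSkew, sub_mulVec, vecMulVec_mulVec]

variable [Fintype n] [DecidableEq n]

/-- The Cayley transform of a square matrix. -/
noncomputable def cayley (A : Matrix n n ℝ) : Matrix n n ℝ := (1 - A) * (1 + A)⁻¹

theorem det_one_add_ne_zero_of_skew {A : Matrix n n ℝ} (hA : Aᵀ = -A) : (1 + A).det ≠ 0 := by
  intro h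
  obtain ⟨v, hv0, hv⟩ := exists_mulVec_eq_zero_iff.2 h
  have h1 : v ⬝ᵥ (A *ᵥ v) = 0 := by
    have : v ⬝ᵥ (A *ᵥ v) = - (v ⬝ᵥ (A *ᵥ v)) := by
      conv_lhs => rw [dotProduct_mulVec, ← mulVec_transpose, hA, dotProduct_comm]
      simp [neg_mulVec]
    linarith
  have h2 : v ⬝ᵥ ((1 + A) *ᵥ v) = 0 := by simp [hv]
  rw [add_mulVec, dotProduct_add, h1, one_mulVec, add_zero, dotProduct_self_eq_zero] at h2
  exact hv0 h2

theorem det_one_sub_of_skew {A : Matrix n n ℝ} (hA : Aᵀ = -A) : (1 - A).det = (1 + A).det := by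
  rw [← det_transpose, transpose_sub, hA, transpose_one, sub_neg_eq_add]

theorem det_cayley {A : Matrix n n ℝ} (hA : Aᵀ = -A) : (cayley A).det = 1 := by
  have h := det_one_add_ne_zero_of_skew hA
  rw [cayley, det_mul, det_one_sub_of_skew hA, ← det_mul, mul_nonsing_inv _ h.isUnit, det_one]

theorem cayley_mem_orthogonalGroup {A : Matrix n n ℝ} (hA : Aᵀ = -A) :
    cayley A ∈ orthogonalGroup n ℝ := by
  have h := (det_one_add_ne_zero_of_skew hA).isUnit
  have h' : IsUnit (1 - A).det := det_one_sub_of_skew hA ▸ h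
  have hT : (cayley A)ᵀ = (1 - A)⁻¹ * (1 + A) := by
    rw [cayley, transpose_mul, transpose_nonsing_inv, transpose_add, transpose_sub, hA]
    simp [sub_eq_add_neg]
  have hcomm : (1 - A) * (1 + A) = (1 + A) * (1 - A) := by noncomm_ring
  rw [mem_orthogonalGroup_iff', hT, cayley, Matrix.mul_assoc, ← Matrix.mul_assoc (1 + A), ← hcomm,
    Matrix.mul_assoc, mul_nonsing_inv _ h, Matrix.mul_one, nonsing_inv_mul _ h']

theorem cayley_zero : cayley (0 : Matrix n n ℝ) = 1 := by simp [cayley]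

theorem cayley_planeSkew_mulVec {x y v : n → ℝ} (hx : x ⬝ᵥ x = 1) (hy : y ⬝ᵥ y = 1)
    (hxy : x ⬝ᵥ y = 0) (hv : y ⬝ᵥ v = 0) :
    cayley (planeSkew x y) *ᵥ v = v + (x ⬝ᵥ v) • (y - x) := by
  have h := (det_one_add_ne_zero_of_skew (transpose_planeSkew x y)).isUnit
  set w : n → ℝ := v + ((x ⬝ᵥ v) / 2) • (y - x) with hw
  have hAw : planeSkew x y *ᵥ w = v - w := by
    rw [planeSkew_mulVec, hw]
    simp only [dotProduct_add, dotProduct_smul, dotProduct_sub, hv, hx, hy, hxy,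
      dotProduct_comm y x]
    ext i
    simp
    ring
  have h1 : (1 + planeSkew x y) *ᵥ w = v := by rw [add_mulVec, hAw, one_mulVec]; abel
  have h2 : (1 + planeSkew x y)⁻¹ *ᵥ v = w := by
    rw [← h1, mulVec_mulVec, nonsing_inv_mul _ h, one_mulVec]
  rw [cayley, ← mulVec_mulVec, h2, sub_mulVec, hAw, one_mulVec, hw]
  ext i
  simp
  ring

end Matrix

theorem contDiff_matrix_det {E : Type*} [NormedAddCommGroup E] [NormedSpace ℝ E] {m : ℕ}
    {F : E → Matrix (Fin m) (Fin m) ℝ} (hF : ∀ i j, ContDiff ℝ ω fun x => F x i j) :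
    ContDiff ℝ ω fun x => (F x).det := by
  simp only [Matrix.det_apply]
  refine ContDiff.sum fun σ _ => ContDiff.const_smul _ (contDiff_prod fun i _ => hF _ _)

theorem contDiff_cayley_planeSkew (d : ℕ) (i j : Fin d) :
    ContDiff ℝ ω fun p : Euc d × Euc d => (Matrix.planeSkew p.1 p.2).cayley i j := by
  have hA (i j : Fin d) : ContDiff ℝ ω fun p : Euc d × Euc d => Matrix.planeSkew p.1 p.2 i j := by
    simp only [Matrix.planeSkew, Matrix.sub_apply, Matrix.vecMulVec_apply]
    fun_prop
  have hB (i j : Fin d) :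
      ContDiff ℝ ω fun p : Euc d × Euc d => (1 + Matrix.planeSkew p.1 p.2 : Matrix _ _ ℝ) i j :=
    contDiff_const.add (hA i j)
  have hC (i j : Fin d) :
      ContDiff ℝ ω fun p : Euc d × Euc d => (1 - Matrix.planeSkew p.1 p.2 : Matrix _ _ ℝ) i j :=
    contDiff_const.sub (hA i j)
  have hI (i j : Fin d) :
      ContDiff ℝ ω fun p : Euc d × Euc d =>
        (1 + Matrix.planeSkew p.1 p.2 : Matrix _ _ ℝ)⁻¹ i j := by
    simp only [Matrix.inv_def, Ring.inverse_eq_inv', Matrix.smul_apply, smul_eq_mul,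
      Matrix.adjugate_apply]
    refine ContDiff.mul (ContDiff.inv (contDiff_matrix_det hB) fun p =>
      Matrix.det_one_add_ne_zero_of_skew (Matrix.transpose_planeSkew _ _))
      (contDiff_matrix_det fun k l => ?_)
    simp only [Matrix.updateRow_apply]
    split_ifs
    · exact contDiff_const
    · exact hB k l
  simp only [Matrix.cayley, Matrix.mul_apply]
  exact ContDiff.sum fun k _ => (hC i k).mul (hI k j)

/-- A family of rotations parametrized by pairs of vectors. -/
noncomputable def cayleyRot (d : ℕ) (p : Euc d × Euc d) : SOG d :=
  ⟨⟨(Matrix.planeSkew p.1 p.2).cayley,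
    Matrix.cayley_mem_orthogonalGroup (Matrix.transpose_planeSkew _ _)⟩,
    Matrix.det_cayley (Matrix.transpose_planeSkew _ _)⟩

theorem continuous_cayleyRot (d : ℕ) : Continuous (cayleyRot d) := by
  refine Continuous.subtype_mk (Continuous.subtype_mk ?_ _) _
  exact continuous_matrix fun i j => (contDiff_cayley_planeSkew d i j).continuous

theorem cayleyRot_zero (d : ℕ) : cayleyRot d 0 = 1 := by
  refine Subtype.ext (Subtype.ext ?_)
  change (Matrix.planeSkew (0 : Fin d → ℝ) 0).cayley = 1
  simp [Matrix.planeSkew, Matrix.cayley_zero]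

instance (d : ℕ) : BorelSpace (SOG d) := ⟨rfl⟩

instance (d : ℕ) : SecondCountableTopology (SOG d) := by
  have : SecondCountableTopology (Matrix (Fin d) (Fin d) ℝ) :=
    inferInstanceAs (SecondCountableTopology (Fin d → Fin d → ℝ))
  have : SecondCountableTopology (Matrix.orthogonalGroup (Fin d) ℝ) :=
    TopologicalSpace.Subtype.secondCountableTopology _
  exact TopologicalSpace.Subtype.secondCountableTopology _

theorem rotLin_mul {d : ℕ} (a b : SOG d) : rotLin (a * b) = rotLin a ∘ₗ rotLin b := by
  exact Matrix.toLpLin_mul 2 2 2 _ _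

theorem rotLin_injective {d : ℕ} (a : SOG d) : Function.Injective (rotLin a) := by
  have h : rotLin a⁻¹ ∘ₗ rotLin a = LinearMap.id := by
    rw [← rotLin_mul, inv_mul_cancel]
    ext v
    simp [rotLin]
  exact Function.LeftInverse.injective (g := rotLin a⁻¹) fun v => LinearMap.congr_fun h v

theorem finrank_map_rotLin {d : ℕ} (ϑ : SOG d) (L : Submodule ℝ (Euc d)) :
    Module.finrank ℝ ↥(L.map (rotLin ϑ)) = Module.finrank ℝ L :=
  (Submodule.equivMapOfInjective (rotLin ϑ) (rotLin_injective ϑ) L).finrank_eq.symm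

/-- The dimension of `L ∩ ϑL'`, computed on the side of `L'`. -/
noncomputable def interDim {d : ℕ} (L L' : Submodule ℝ (Euc d)) (ϑ : SOG d) : ℕ :=
  Module.finrank ℝ ↥(L' ⊓ L.comap (rotLin ϑ))

theorem finrank_inf_map_rotLin {d : ℕ} (L L' : Submodule ℝ (Euc d)) (ϑ : SOG d) :
    Module.finrank ℝ ↥(L ⊓ L'.map (rotLin ϑ)) = interDim L L' ϑ := by
  rw [interDim, inf_comm, Submodule.map_inf_eq_map_inf_comap, finrank_map_rotLin]

/-- Some rotation of the form `cayleyRot p` reduces the dimension of a non-generic intersection. -/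
theorem exists_interDim_cayleyRot_mul_lt {d : ℕ} (L L' : Submodule ℝ (Euc d)) (ϑ : SOG d)
    (h0 : 0 < interDim L L' ϑ)
    (h : Module.finrank ℝ L + Module.finrank ℝ L' < interDim L L' ϑ + d) :
    ∃ p, interDim L L' (cayleyRot d p * ϑ) < interDim L L' ϑ := by
  set M := L'.map (rotLin ϑ) with hM
  rw [← finrank_inf_map_rotLin] at h0 h ⊢
  obtain ⟨x, hx, hx1⟩ : ∃ x ∈ L ⊓ M, ‖x‖ = 1 := by
    have := Module.finrank_pos_iff_exists_ne_zero.1 h0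
    obtain ⟨⟨x, hx⟩, hx0⟩ := this
    have hx0' : x ≠ 0 := fun h => hx0 (Subtype.ext h)
    exact ⟨‖x‖⁻¹ • x, Submodule.smul_mem _ _ hx, norm_smul_inv_norm hx0'⟩
  obtain ⟨y, hy, hy1⟩ : ∃ y ∈ (L ⊔ M)ᗮ, ‖y‖ = 1 := by
    have hne : (L ⊔ M)ᗮ ≠ ⊥ := by
      rw [Ne, Submodule.orthogonal_eq_bot_iff]
      intro htop
      have e := Submodule.finrank_sup_add_finrank_inf_eq L M
      rw [htop, finrank_top, finrank_euclideanSpace, Fintype.card_fin, hM, finrank_map_rotLin] at e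
      omega
    obtain ⟨y, hy, hy0⟩ := Submodule.exists_mem_ne_zero_of_ne_bot hne
    exact ⟨‖y‖⁻¹ • y, Submodule.smul_mem _ _ hy, norm_smul_inv_norm hy0⟩
  have hyL : ∀ v ∈ L, ⟪y, v⟫ = 0 := fun v hv =>
    Submodule.inner_left_of_mem_orthogonal (Submodule.mem_sup_left hv) hy
  have hyM : ∀ v ∈ M, ⟪y, v⟫ = 0 := fun v hv =>
    Submodule.inner_left_of_mem_orthogonal (Submodule.mem_sup_right hv) hy
  have hdot (u v : Euc d) : u.ofLp ⬝ᵥ v.ofLp = ⟪u, v⟫ := by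
    rw [EuclideanSpace.inner_eq_star_dotProduct, dotProduct_comm]; simp
  have hrot (v : Euc d) (hv : v ∈ M) :
      rotLin (cayleyRot d (x, y)) v = v + ⟪x, v⟫ • (y - x) := by
    have := Matrix.cayley_planeSkew_mulVec (x := x.ofLp) (y := y.ofLp) (v := v.ofLp)
      (by rw [hdot]; simp [hx1]) (by rw [hdot]; simp [hy1])
      (by rw [hdot, real_inner_comm]; exact hyL x hx.1) (by rw [hdot]; exact hyM v hv)
    rw [hdot] at this
    exact congrArg (WithLp.toLp 2) this
  refine ⟨(x, y), ?_⟩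
  rw [interDim, rotLin_mul, Submodule.comap_comp, ← finrank_map_rotLin ϑ,
    ← Submodule.map_inf_eq_map_inf_comap, ← hM]
  have hmem : ∀ v ∈ M ⊓ L.comap (rotLin (cayleyRot d (x, y))), v ∈ L ⊓ M ∧ ⟪x, v⟫ = 0 := by
    rintro v ⟨hvM, hvL⟩
    rw [SetLike.mem_coe, Submodule.mem_comap, hrot v hvM] at hvL
    have h1 := hyL _ hvL
    rw [inner_add_right, hyM v hvM, inner_smul_right, inner_sub_right, hyL x hx.1,
      real_inner_self_eq_norm_sq, hy1] at h1
    have h2 : ⟪x, v⟫ = 0 := by linarith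
    rw [h2, zero_smul, add_zero] at hvL
    exact ⟨⟨hvL, hvM⟩, h2⟩
  refine Submodule.finrank_lt_finrank_of_lt
    (SetLike.lt_iff_le_and_exists.2 ⟨fun v hv => (hmem v hv).1, x, hx, fun hx' => ?_⟩)
  have := (hmem x hx').2
  rw [real_inner_self_eq_norm_sq, hx1] at this
  norm_num at this

theorem isClosed_le_interDim {d : ℕ} (L L' : Submodule ℝ (Euc d)) (r : ℕ) :
    IsClosed {ϑ : SOG d | r ≤ interDim L L' ϑ} := by
  rw [← isOpen_compl_iff, isOpen_iff_mem_nhds]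
  intro ϑ hϑ
  obtain ⟨n, Λ, h1, h2⟩ := exists_det_ne_zero_finrank_le
    (Matrix.toEuclideanLin (𝕜 := ℝ) (m := Fin d) (n := Fin d)).toLinearMap L L' ϑ.1.1
  have hc : Continuous fun ψ : SOG d => (Λ ψ.1.1).det :=
    (Λ.continuous_of_finiteDimensional.comp
      (continuous_subtype_val.comp continuous_subtype_val)).matrix_det
  filter_upwards [hc.continuousAt.eventually_ne h1] with ψ hψ
  have := h2 _ hψ
  simp only [mem_compl_iff, mem_ofPred_eq, not_le] at hϑ ⊢
  exact this.trans_lt hϑ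

theorem volume_le_interDim_cayleyRot_mul {d : ℕ} (L L' : Submodule ℝ (Euc d)) (ϑ : SOG d) (r : ℕ)
    (h : ∃ p, interDim L L' (cayleyRot d p * ϑ) < r) :
    ((volume : Measure (Euc d)).prod (volume : Measure (Euc d)))
      {p | r ≤ interDim L L' (cayleyRot d p * ϑ)} = 0 := by
  obtain ⟨p₀, hp₀⟩ := h
  obtain ⟨n, Λ, h1, h2⟩ := exists_det_ne_zero_finrank_le
    (Matrix.toEuclideanLin (𝕜 := ℝ) (m := Fin d) (n := Fin d)).toLinearMap L L'
    (cayleyRot d p₀ * ϑ).1.1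
  have hentry (i j : Fin d) :
      ContDiff ℝ ω fun p : Euc d × Euc d => (cayleyRot d p * ϑ).1.1 i j := by
    change ContDiff ℝ ω fun p : Euc d × Euc d =>
      ((Matrix.planeSkew p.1 p.2).cayley * ϑ.1.1) i j
    simp only [Matrix.mul_apply]
    exact ContDiff.sum fun k _ => (contDiff_cayley_planeSkew d i k).mul contDiff_const
  have han : ContDiff ℝ ω fun p : Euc d × Euc d => (Λ (cayleyRot d p * ϑ).1.1).det := by
    refine contDiff_matrix_det fun k l => ?_
    have (A : Matrix (Fin d) (Fin d) ℝ) :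
        Λ A k l = ∑ i, ∑ j, A i j * Λ (Matrix.single i j 1) k l := by
      conv_lhs => rw [Matrix.matrix_eq_sum_single A]
      simp only [map_sum, Matrix.sum_apply]
      refine Finset.sum_congr rfl fun i _ => Finset.sum_congr rfl fun j _ => ?_
      rw [show Matrix.single i j (A i j) = A i j • Matrix.single i j (1 : ℝ) by simp, map_smul]
      rfl
    rw [funext fun p => this (cayleyRot d p * ϑ).1.1]
    exact ContDiff.sum fun i _ => ContDiff.sum fun j _ => (hentry i j).mul contDiff_const
  refine measure_mono_null (fun p hp => ?_) (addHaar_zeros_of_contDiff_omega _ han h1)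
  by_contra hne
  exact absurd ((h2 _ hne).trans_lt hp₀) (not_lt.2 hp)

theorem measure_le_interDim_eq_zero {d : ℕ} (L L' : Submodule ℝ (Euc d))
    (ν : Measure (SOG d)) [ν.IsMulLeftInvariant] [IsProbabilityMeasure ν] (r : ℕ)
    (h0 : 0 < r) (hr : Module.finrank ℝ L + Module.finrank ℝ L' < r + d) :
    ν {ϑ | r ≤ interDim L L' ϑ} = 0 := by
  induction hk : d + 1 - r generalizing r with
  | zero =>
    convert measure_empty (μ := ν)
    ext ϑ
    have : interDim L L' ϑ ≤ d := (Submodule.finrank_le _).trans_eq (by simp)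
    simp
    omega
  | succ k ih =>
    specialize ih (r + 1) (by omega) (by omega) (by omega)
    set Z := {ϑ : SOG d | r ≤ interDim L L' ϑ} with hZ
    let vol := (volume : Measure (Euc d)).prod (volume : Measure (Euc d))
    have hm : Measurable fun q : SOG d × (Euc d × Euc d) => cayleyRot d q.2 * q.1 :=
      (((continuous_cayleyRot d).comp continuous_snd).mul continuous_fst).measurable
    have hm' : Measurable fun q : (Euc d × Euc d) × SOG d => cayleyRot d q.1 * q.2 :=
      (((continuous_cayleyRot d).comp continuous_fst).mul continuous_snd).measurable
    have hZm : MeasurableSet Z := (isClosed_le_interDim L L' r).measurableSet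
    have hZm' : MeasurableSet {q : (Euc d × Euc d) × SOG d | cayleyRot d q.1 * q.2 ∈ Z} := hm' hZm
    have hprod : (vol.prod ν) {q | cayleyRot d q.1 * q.2 ∈ Z} = 0 := by
      rw [← Measure.prod_swap, Measure.map_apply measurable_swap hZm']
      refine (Measure.measure_prod_null (hm hZm)).2 ?_
      filter_upwards [measure_eq_zero_iff_ae_notMem.1 ih] with ϑ hϑ
      refine volume_le_interDim_cayleyRot_mul L L' ϑ r ?_
      simp only [not_le] at hϑ
      rcases (Nat.lt_succ_iff.1 hϑ).lt_or_eq with hlt | heq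
      · exact ⟨0, by rwa [cayleyRot_zero, one_mul]⟩
      · subst heq
        exact exists_interDim_cayleyRot_mul_lt L L' ϑ h0 hr
    obtain ⟨p, hp⟩ := (Measure.measure_ae_null_of_prod_null hprod).exists
    rw [← measure_preimage_mul ν (cayleyRot d p) Z]
    exact hp

theorem le_interDim {d : ℕ} (L L' : Submodule ℝ (Euc d)) (ϑ : SOG d) :
    Module.finrank ℝ L + Module.finrank ℝ L' ≤ interDim L L' ϑ + d := by
  have e := Submodule.finrank_sup_add_finrank_inf_eq L (L'.map (rotLin ϑ))
  rw [finrank_inf_map_rotLin, finrank_map_rotLin] at e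
  have : Module.finrank ℝ ↥(L ⊔ L'.map (rotLin ϑ)) ≤ d :=
    (Submodule.finrank_le _).trans_eq (by simp)
  omega

/-- **Lemma 3.1.** For linear subspaces `L, L' ⊆ ℝ^d`, the set of rotations `ϑ ∈ SO(d)` for
which `L` and `ϑL'` are in special position (not in general position, i.e.
`dim(L ∩ ϑL') ≠ max{0, dim L + dim L' − d}`) has `ν`-measure zero. -/
theorem special_position_measure_zero {d : ℕ} (L L' : Submodule ℝ (Euc d))
    (ν : Measure (SOG d)) [ν.IsHaarMeasure] [IsProbabilityMeasure ν] :
    ν {ϑ : SOG d |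
      ¬ ((Module.finrank ℝ ↥(L ⊓ Submodule.map (rotLin ϑ) L') : ℤ)
          = max 0 ((Module.finrank ℝ ↥L : ℤ) + (Module.finrank ℝ ↥L' : ℤ) - d)) } = 0 := by
  refine measure_mono_null (fun ϑ hϑ => ?_) (measure_le_interDim_eq_zero L L' ν
    (Module.finrank ℝ L + Module.finrank ℝ L' - d + 1) (by omega) (by omega))
  rw [mem_ofPred_eq, finrank_inf_map_rotLin] at hϑ
  have := le_interDim L L' ϑ
  rw [mem_ofPred_eq]
  omega
end

section
/- Let C, D ⊂ ℝ^d be polyhedral convex cones. Then: (i) every face of C ∩ D is of the form F ∩ G with F a face of C and G a face of D; (ii) for faces F of C and G of D with F ∩ G a face of C ∩ D, the normal cones satisfy N(C ∩ D, F ∩ G) ⊇ N(C, F) + N(D, G); (iii) if relint F ∩ relint G ≠ ∅, then N(C ∩ D, F ∩ G) = N(C, F) + N(D, G); (iv) if F and G intersect transversely, then N(C ∩ D, F ∩ G) = N(C, F) + N(D, G) and this sum is direct, i.e., L(N(C,F)) ∩ L(N(D,G)) = {o}. -/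
open MeasureTheory Set
open scoped ENNReal RealInnerProductSpace Pointwise

/-- **Farkas' lemma** for a finite family of vectors in an inner product space. -/
theorem exists_nonneg_sum_smul_of_inner_le {E ι : Type*} [NormedAddCommGroup E]
    [InnerProductSpace ℝ E] (s : Finset ι) (u : ι → E) (w : E)
    (h : ∀ x : E, (∀ i ∈ s, ⟪u i, x⟫ ≤ 0) → ⟪w, x⟫ ≤ 0) :
    ∃ c : ι → ℝ, (∀ i, 0 ≤ c i) ∧ w = ∑ i ∈ s, c i • u i := by
  classical
  induction s using Finset.induction_on generalizing u w with
  | empty =>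
    refine ⟨fun _ => 0, fun _ => le_rfl, ?_⟩
    simpa using h w (by simp)
  | insert a s ha ih =>
    by_cases hs : ∀ x : E, (∀ i ∈ s, ⟪u i, x⟫ ≤ 0) → ⟪w, x⟫ ≤ 0
    · obtain ⟨c, hc, rfl⟩ := ih u w hs
      refine ⟨fun i => if i = a then 0 else c i, fun i => ?_, ?_⟩
      · dsimp only
        split_ifs
        exacts [le_rfl, hc i]
      · beta_reduce
        rw [Finset.sum_insert ha, if_pos rfl, zero_smul, zero_add]
        refine Finset.sum_congr rfl fun i hi => ?_
        rw [if_neg (ne_of_mem_of_not_mem hi ha)]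
    · push Not at hs
      obtain ⟨z, hz, hwz⟩ := hs
      have haz : 0 < ⟪u a, z⟫ := by
        by_contra hneg
        push Not at hneg
        exact absurd (h z (by simpa using ⟨hneg, hz⟩)) (not_le.2 hwz)
      set t : ℝ := ⟪u a, z⟫ with ht
      obtain ⟨c, hc, hcw⟩ := ih (fun i => u i - (⟪u i, z⟫ / t) • u a)
        (w - (⟪w, z⟫ / t) • u a) (by
          intro x hx
          have key : ∀ v : E, ⟪v - (⟪v, z⟫ / t) • u a, x⟫ = ⟪v, x - (⟪u a, x⟫ / t) • z⟫ := by
            intro v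
            rw [inner_sub_left, inner_sub_right, real_inner_smul_left, real_inner_smul_right]
            ring
          rw [key]
          refine h _ fun i hi => ?_
          rcases Finset.mem_insert.1 hi with rfl | hi
          · rw [inner_sub_right, real_inner_smul_right, ← ht, div_mul_cancel₀ _ haz.ne', sub_self]
          · rw [← key]
            exact hx i hi)
      have hsum : ∑ i ∈ s, c i * (⟪u i, z⟫ / t) ≤ 0 :=
        Finset.sum_nonpos fun i hi =>
          mul_nonpos_of_nonneg_of_nonpos (hc i) (div_nonpos_of_nonpos_of_nonneg (hz i hi) haz.le)
      refine ⟨fun i => if i = a then ⟪w, z⟫ / t - ∑ i ∈ s, c i * (⟪u i, z⟫ / t) else c i,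
        fun i => ?_, ?_⟩
      · dsimp only
        split_ifs
        · linarith [div_pos hwz haz]
        · exact hc i
      · beta_reduce
        rw [Finset.sum_insert ha, if_pos rfl,
          Finset.sum_congr rfl (g := fun i => c i • u i)
            fun i hi => by rw [if_neg (ne_of_mem_of_not_mem hi ha)]]
        refine (sub_eq_iff_eq_add.1 hcw).trans ?_
        simp only [smul_sub, Finset.sum_sub_distrib, sub_smul, smul_smul, Finset.sum_smul]
        abel

/-- Moving a little from a relative interior point in a direction of the affine hull stays in the
set. -/
theorem eventually_add_smul_mem_of_mem_intrinsicInterior {E : Type*} [NormedAddCommGroup E]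
    [NormedSpace ℝ E] {s : Set E} {x v : E} (hx : x ∈ intrinsicInterior ℝ s)
    (hv : v ∈ (affineSpan ℝ s).direction) : ∀ᶠ ε : ℝ in nhds 0, x + ε • v ∈ s := by
  obtain ⟨y, hy, rfl⟩ := mem_intrinsicInterior.1 hx
  have hmem : ∀ ε : ℝ, (y : E) + ε • v ∈ affineSpan ℝ s := fun ε => by
    rw [add_comm]
    exact AffineSubspace.vadd_mem_of_mem_direction (Submodule.smul_mem _ ε hv) y.2
  have hcont : Continuous fun ε : ℝ => (⟨(y : E) + ε • v, hmem ε⟩ : affineSpan ℝ s) := by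
    fun_prop
  have h0 : (⟨(y : E) + (0 : ℝ) • v, hmem 0⟩ : affineSpan ℝ s) = y := by
    ext
    simp
  have := hcont.continuousAt (x := (0 : ℝ))
    |>.eventually_mem (by rw [h0]; exact mem_interior_iff_mem_nhds.1 hy)
  exact this

theorem IsPolyCone.smul_mem {d : ℕ} {C : Set (Euc d)} (hC : IsPolyCone C) {x : Euc d} (hx : x ∈ C)
    {r : ℝ} (hr : 0 ≤ r) : r • x ∈ C := by
  obtain ⟨U, rfl⟩ := hC
  simp only [mem_iInter, mem_ofPred_eq, real_inner_smul_right] at hx ⊢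
  exact fun u hu => mul_nonpos_of_nonneg_of_nonpos hr (hx u hu)

theorem IsFace.zero_mem {d : ℕ} {C F : Set (Euc d)} (hC : IsPolyCone C) (hF : IsFace C F) :
    (0 : Euc d) ∈ F := by
  obtain ⟨y, hy⟩ := hF.2.2
  have hyC := hF.1.subset hy
  refine hF.1.left_mem_of_mem_openSegment (x := 0) (y := (2 : ℝ) • y) (z := y) ?_
    (hC.smul_mem hyC zero_le_two) hy ?_
  · simpa using hC.smul_mem hyC le_rfl
  · exact ⟨1 / 2, 1 / 2, by norm_num, by norm_num, by norm_num, by simp [smul_smul]⟩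

/-- A relative interior point of a set containing the origin can be moved a little in any direction
of the linear hull. -/
theorem eventually_add_smul_mem_of_mem_linHull {d : ℕ} {F : Set (Euc d)} (h0 : (0 : Euc d) ∈ F)
    {x v : Euc d} (hx : x ∈ intrinsicInterior ℝ F) (hv : v ∈ linHull F) :
    ∀ᶠ ε : ℝ in nhds 0, x + ε • v ∈ F := by
  refine eventually_add_smul_mem_of_mem_intrinsicInterior hx ?_
  rw [direction_affineSpan, vectorSpan_eq_span_vsub_set_right ℝ h0]
  simpa [linHull] using hv

/-- A linear form that is nonpositive on a set containing the origin and vanishes at a relative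
interior point vanishes on the whole set. -/
theorem inner_eq_zero_of_mem_intrinsicInterior {d : ℕ} {F : Set (Euc d)} (h0 : (0 : Euc d) ∈ F)
    {x u : Euc d} (hx : x ∈ intrinsicInterior ℝ F) (hF : ∀ y ∈ F, ⟪u, y⟫ ≤ 0)
    (hux : ⟪u, x⟫ = 0) {y : Euc d} (hy : y ∈ F) : ⟪u, y⟫ = 0 := by
  refine le_antisymm (hF y hy) ?_
  obtain ⟨ε, hεF, hε⟩ := (((eventually_add_smul_mem_of_mem_linHull h0 hx
    (neg_mem (Submodule.subset_span hy))).filter_mono nhdsWithin_le_nhds).and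
      (self_mem_nhdsWithin (s := Ioi (0 : ℝ)))).exists
  have := hF _ hεF
  rw [inner_add_right, hux, real_inner_smul_right, inner_neg_right] at this
  have hε' : (0 : ℝ) < ε := hε
  by_contra hneg
  push Not at hneg
  nlinarith [mul_pos hε' (neg_pos.2 hneg)]

/-- At a point of a polyhedral cone one can move a little in each direction that satisfies the
active constraints. -/
theorem eventually_add_smul_mem_biInter {d : ℕ} {U : Finset (Euc d)} {x v : Euc d}
    (hx : ∀ u ∈ U, ⟪u, x⟫ ≤ 0) (hv : ∀ u ∈ U, ⟪u, x⟫ = 0 → ⟪u, v⟫ ≤ 0) :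
    ∀ᶠ ε : ℝ in nhdsWithin 0 (Ioi 0), ∀ u ∈ U, ⟪u, x + ε • v⟫ ≤ 0 := by
  rw [Filter.eventually_all_finset]
  intro u hu
  rcases (hx u hu).lt_or_eq with hlt | heq
  · have hcont : Continuous fun ε : ℝ => ⟪u, x + ε • v⟫ := by fun_prop
    have := hcont.continuousAt (x := (0 : ℝ)) |>.eventually_lt
      (continuousAt_const (y := (0 : ℝ))) (by simpa using hlt)
    exact (this.filter_mono nhdsWithin_le_nhds).mono fun _ h => h.le
  · filter_upwards [self_mem_nhdsWithin] with ε hε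
    rw [inner_add_right, heq, zero_add, real_inner_smul_right]
    exact mul_nonpos_of_nonneg_of_nonpos (le_of_lt hε) (hv u hu heq)

/-- The subset of a polyhedral cone where the constraints active at a given point are tight is a
face. -/
theorem isFace_active {d : ℕ} {U : Finset (Euc d)} {x : Euc d} (hx : ∀ u ∈ U, ⟪u, x⟫ ≤ 0) :
    IsFace (⋂ u ∈ U, {y | ⟪u, y⟫ ≤ 0})
      {y | (∀ u ∈ U, ⟪u, y⟫ ≤ 0) ∧ ∀ u ∈ U, ⟪u, x⟫ = 0 → ⟪u, y⟫ = 0} := by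
  refine ⟨⟨fun y hy => ?_, ?_⟩, ?_, ⟨x, hx, fun u _ h => h⟩⟩
  · simpa using hy.1
  · rintro y hy z hz _ hw ⟨a, b, ha, hb, -, rfl⟩
    simp only [mem_iInter, mem_ofPred_eq] at hy hz
    refine ⟨hy, fun u hu hux => le_antisymm (hy u hu) ?_⟩
    have := hw.2 u hu hux
    rw [inner_add_right, real_inner_smul_right, real_inner_smul_right] at this
    by_contra hneg
    push Not at hneg
    nlinarith [mul_pos ha (neg_pos.2 hneg), mul_nonneg hb.le (neg_nonneg.2 (hz u hu))]
  · rintro y hy z hz a b ha hb -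
    refine ⟨fun u hu => ?_, fun u hu hux => ?_⟩
    · rw [inner_add_right, real_inner_smul_right, real_inner_smul_right]
      exact add_nonpos (mul_nonpos_of_nonneg_of_nonpos ha (hy.1 u hu))
        (mul_nonpos_of_nonneg_of_nonpos hb (hz.1 u hu))
    · rw [inner_add_right, real_inner_smul_right, real_inner_smul_right, hy.2 u hu hux,
        hz.2 u hu hux]
      simp

/-- A face of a polyhedral cone is cut out by the constraints active at any of its relative interior
points. -/
theorem IsFace.eq_active {d : ℕ} {U : Finset (Euc d)} {J : Set (Euc d)}
    (hJ : IsFace (⋂ u ∈ U, {y | ⟪u, y⟫ ≤ 0}) J) {x : Euc d} (hx : x ∈ intrinsicInterior ℝ J) :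
    J = {y | (∀ u ∈ U, ⟪u, y⟫ ≤ 0) ∧ ∀ u ∈ U, ⟪u, x⟫ = 0 → ⟪u, y⟫ = 0} := by
  have hsub : ∀ y ∈ J, ∀ u ∈ U, ⟪u, y⟫ ≤ 0 := fun y hy => by simpa using hJ.1.subset hy
  have hxJ := intrinsicInterior_subset hx
  ext y
  refine ⟨fun hy => ⟨hsub y hy, fun u hu hux => ?_⟩, fun ⟨hyC, hy⟩ => ?_⟩
  · exact inner_eq_zero_of_mem_intrinsicInterior (hJ.zero_mem ⟨U, rfl⟩) hx
      (fun z hz => hsub z hz u hu) hux hy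
  · obtain ⟨ε, hεU, hε⟩ := ((eventually_add_smul_mem_biInter (v := x - y) (hsub x hxJ)
      (fun u hu hux => by rw [inner_sub_right, hux, hy u hu hux, sub_zero])).and
      self_mem_nhdsWithin).exists
    have hε : (0 : ℝ) < ε := hε
    refine hJ.1.left_mem_of_mem_openSegment (x := y) (y := x + ε • (x - y)) (z := x)
      (by simpa using hyC) (by simpa using hεU) hxJ
      ⟨ε / (1 + ε), 1 / (1 + ε), by positivity, by positivity, by field_simp; ring, ?_⟩
    have : (1 + ε) ≠ 0 := by positivity
    match_scalars <;> field_simp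
    ring

theorem normalCone_add_subset {d : ℕ} (C D F G : Set (Euc d)) :
    normalCone C F + normalCone D G ⊆ normalCone (C ∩ D) (F ∩ G) := by
  rintro _ ⟨u, hu, v, hv, rfl⟩
  refine ⟨fun y hy => ?_, fun x hx => ?_⟩
  · rw [inner_add_left]
    exact add_nonpos (hu.1 y hy.1) (hv.1 y hy.2)
  · rw [inner_add_left, hu.2 x hx.1, hv.2 x hx.2, add_zero]

/-- A nonnegative combination of constraint vectors that are active at a relative interior point of
a face is a normal vector at this face. -/
theorem IsFace.sum_smul_mem_normalCone {d : ℕ} {U : Finset (Euc d)} {F : Set (Euc d)}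
    (hF : IsFace (⋂ u ∈ U, {y | ⟪u, y⟫ ≤ 0}) F) {x : Euc d} (hx : x ∈ intrinsicInterior ℝ F)
    {A : Finset (Euc d)} (hA : ∀ u ∈ A, u ∈ U ∧ ⟪u, x⟫ = 0) {c : Euc d → ℝ} (hc : ∀ u, 0 ≤ c u) :
    ∑ u ∈ A, c u • u ∈ normalCone (⋂ u ∈ U, {y | ⟪u, y⟫ ≤ 0}) F := by
  refine ⟨fun y hy => ?_, fun y hy => ?_⟩
  · simp only [mem_iInter, mem_ofPred_eq] at hy
    rw [sum_inner]
    refine Finset.sum_nonpos fun u hu => ?_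
    rw [real_inner_smul_left]
    exact mul_nonpos_of_nonneg_of_nonpos (hc u) (hy u (hA u hu).1)
  · rw [hF.eq_active hx] at hy
    rw [sum_inner]
    refine Finset.sum_eq_zero fun u hu => ?_
    rw [real_inner_smul_left, hy.2 u (hA u hu).1 (hA u hu).2, mul_zero]

theorem normalCone_inter_eq_add {d : ℕ} {C D F G : Set (Euc d)} (hC : IsPolyCone C) (hD : IsPolyCone D)
    (hF : IsFace C F) (hG : IsFace D G)
    (hFG : (intrinsicInterior ℝ F ∩ intrinsicInterior ℝ G).Nonempty) :
    normalCone (C ∩ D) (F ∩ G) = normalCone C F + normalCone D G := by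
  classical
  refine Subset.antisymm (fun w hw => ?_) (normalCone_add_subset C D F G)
  obtain ⟨x, hxF, hxG⟩ := hFG
  obtain ⟨U, rfl⟩ := hC
  obtain ⟨V, rfl⟩ := hD
  have hxF' := intrinsicInterior_subset hxF
  have hxG' := intrinsicInterior_subset hxG
  have hxU : ∀ u ∈ U, ⟪u, x⟫ ≤ 0 := by simpa using hF.1.subset hxF'
  have hxV : ∀ u ∈ V, ⟪u, x⟫ ≤ 0 := by simpa using hG.1.subset hxG'
  set A := U.filter fun u => ⟪u, x⟫ = 0 with hA
  set B := V.filter fun u => ⟪u, x⟫ = 0 with hB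
  obtain ⟨c, hc, hcw⟩ := exists_nonneg_sum_smul_of_inner_le (A ∪ B) id w (by
    intro v hv
    obtain ⟨ε, ⟨hεU, hεV⟩, hε⟩ := (((eventually_add_smul_mem_biInter (v := v) hxU
      (fun u hu hux => hv u (by simp [hA, hu, hux]))).and
      (eventually_add_smul_mem_biInter (v := v) hxV
      (fun u hu hux => hv u (by simp [hB, hu, hux])))).and self_mem_nhdsWithin).exists
    have hε : (0 : ℝ) < ε := hε
    have := hw.1 (x + ε • v) ⟨by simpa using hεU, by simpa using hεV⟩
    rw [inner_add_right, hw.2 x ⟨hxF', hxG'⟩, zero_add, real_inner_smul_right] at this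
    exact nonpos_of_mul_nonpos_right this hε)
  rw [← Finset.union_sdiff_self_eq_union, Finset.sum_union Finset.disjoint_sdiff] at hcw
  rw [hcw]
  refine add_mem_add (hF.sum_smul_mem_normalCone hxF (fun u hu => ?_) hc)
    (hG.sum_smul_mem_normalCone hxG (fun u hu => ?_) hc)
  · simpa [hA] using hu
  · exact Finset.mem_filter.1 (Finset.mem_sdiff.1 hu).1

theorem linHull_inter {d : ℕ} {F G : Set (Euc d)} (hF : (0 : Euc d) ∈ F) (hG : (0 : Euc d) ∈ G)
    (hFG : (intrinsicInterior ℝ F ∩ intrinsicInterior ℝ G).Nonempty) :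
    linHull (F ∩ G) = linHull F ⊓ linHull G := by
  refine le_antisymm (le_inf (Submodule.span_mono inter_subset_left)
    (Submodule.span_mono inter_subset_right)) fun v hv => ?_
  obtain ⟨x, hxF, hxG⟩ := hFG
  obtain ⟨ε, ⟨hεF, hεG⟩, hε⟩ := ((((eventually_add_smul_mem_of_mem_linHull hF hxF hv.1).and
    (eventually_add_smul_mem_of_mem_linHull hG hxG hv.2)).filter_mono nhdsWithin_le_nhds).and
    (self_mem_nhdsWithin (s := Ioi (0 : ℝ)))).exists
  have hε : (0 : ℝ) < ε := hε
  have hx : x ∈ linHull (F ∩ G) :=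
    Submodule.subset_span ⟨intrinsicInterior_subset hxF, intrinsicInterior_subset hxG⟩
  have hxv : x + ε • v ∈ linHull (F ∩ G) := Submodule.subset_span ⟨hεF, hεG⟩
  exact (Submodule.smul_mem_iff _ hε.ne').1 ((Submodule.add_mem_iff_right _ hx).1 hxv)

theorem linHull_normalCone_le {d : ℕ} (C F : Set (Euc d)) : linHull (normalCone C F) ≤ (linHull F)ᗮ := by
  refine Submodule.span_le.2 fun u hu => (Submodule.mem_orthogonal' _ _).2 fun v hv => ?_
  have : linHull F ≤ LinearMap.ker (innerₛₗ ℝ u) := Submodule.span_le.2 fun x hx => hu.2 x hx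
  exact this hv

theorem linHull_normalCone_inf_eq_bot {d : ℕ} {C D F G : Set (Euc d)} (hF : (0 : Euc d) ∈ F)
    (hG : (0 : Euc d) ∈ G) (hFG : Transverse F G) :
    linHull (normalCone C F) ⊓ linHull (normalCone D G) = ⊥ := by
  have hsup : linHull F ⊔ linHull G = ⊤ := by
    apply Submodule.eq_top_of_finrank_eq
    have h1 := Submodule.finrank_sup_add_finrank_inf_eq (linHull F) (linHull G)
    have h2 := hFG.1
    simp only [dimS] at h2
    rw [linHull_inter hF hG hFG.2] at h2
    rw [finrank_euclideanSpace_fin]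
    omega
  rw [eq_bot_iff, ← Submodule.top_orthogonal_eq_bot, ← hsup, ← Submodule.inf_orthogonal]
  exact inf_le_inf (linHull_normalCone_le C F) (linHull_normalCone_le D G)

theorem IsFace.exists_eq_inter {d : ℕ} {C D J : Set (Euc d)} (hC : IsPolyCone C) (hD : IsPolyCone D)
    (hJ : IsFace (C ∩ D) J) : ∃ F G : Set (Euc d), IsFace C F ∧ IsFace D G ∧ J = F ∩ G := by
  classical
  obtain ⟨U, rfl⟩ := hC
  obtain ⟨V, rfl⟩ := hD
  obtain ⟨x, hx⟩ := hJ.2.2.intrinsicInterior hJ.2.1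
  have hxUV := hJ.1.subset (intrinsicInterior_subset hx)
  refine ⟨_, _, isFace_active (x := x) (by simpa using hxUV.1),
    isFace_active (x := x) (by simpa using hxUV.2), ?_⟩
  have hUV : ((⋂ u ∈ U, {y : Euc d | ⟪u, y⟫ ≤ 0}) ∩ ⋂ u ∈ V, {y : Euc d | ⟪u, y⟫ ≤ 0}) =
      ⋂ u ∈ U ∪ V, {y : Euc d | ⟪u, y⟫ ≤ 0} := by
    ext y
    simp [or_imp, forall_and]
  rw [hUV] at hJ
  rw [hJ.eq_active hx]
  ext y
  simp only [Finset.mem_union, mem_ofPred_eq, mem_inter_iff, or_imp, forall_and]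
  tauto


/-- **Lemma 3.2** (faces and normal cones of intersections). Let `C, D ⊆ ℝ^d` be polyhedral
cones. (i) Every face of `C ∩ D` has the form `F ∩ G` with `F` a face of `C`, `G` a face of `D`.
(ii) If `F ∩ G` is a face of `C ∩ D` then `N(C∩D, F∩G) ⊇ N(C,F) + N(D,G)`.
(iii) If `relint F ∩ relint G ≠ ∅` then equality holds.
(iv) If `F ⋔ G` then equality holds and the sum is direct. -/
theorem faces_normal_cones_of_intersection {d : ℕ} (C D : Set (Euc d))
    (hC : IsPolyCone C) (hD : IsPolyCone D) :
    (∀ J : Set (Euc d), IsFace (C ∩ D) J →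
      ∃ F G : Set (Euc d), IsFace C F ∧ IsFace D G ∧ J = F ∩ G) ∧
    (∀ F G : Set (Euc d), IsFace C F → IsFace D G → IsFace (C ∩ D) (F ∩ G) →
      normalCone C F + normalCone D G ⊆ normalCone (C ∩ D) (F ∩ G)) ∧
    (∀ F G : Set (Euc d), IsFace C F → IsFace D G →
      (intrinsicInterior ℝ F ∩ intrinsicInterior ℝ G).Nonempty →
      normalCone (C ∩ D) (F ∩ G) = normalCone C F + normalCone D G) ∧
    (∀ F G : Set (Euc d), IsFace C F → IsFace D G → Transverse F G →
      normalCone (C ∩ D) (F ∩ G) = normalCone C F + normalCone D G ∧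
        linHull (normalCone C F) ⊓ linHull (normalCone D G) = ⊥) := by
  refine ⟨fun J hJ => hJ.exists_eq_inter hC hD, fun F G _ _ _ => normalCone_add_subset C D F G,
    fun F G hF hG hFG => normalCone_inter_eq_add hC hD hF hG hFG, fun F G hF hG hFG =>
      ⟨normalCone_inter_eq_add hC hD hF hG hFG.2,
        linHull_normalCone_inf_eq_bot (hF.zero_mem hC) (hG.zero_mem hD) hFG⟩⟩
end

section
/- Let C ⊆ ℝ^d be a polyhedral convex cone. Then for every x ∈ ℝ^d, the point x lies in relint F + N(C,F) for exactly one face F of C; equivalently, Σ_{F ∈ F(C)} 1_{(relint F) + N(C,F)}(x) = 1 for all x ∈ ℝ^d, where F(C) is the set of all faces of C. -/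
open MeasureTheory Set
open scoped ENNReal RealInnerProductSpace Pointwise

section RelativeInterior

variable {V : Type*} [NormedAddCommGroup V] [NormedSpace ℝ V] {C F G : Set V} {p y : V}

/-- A segment ending at a relative interior point of `F` can be prolonged inside `F`. -/
theorem exists_mem_openSegment_of_mem_intrinsicInterior (hp : p ∈ intrinsicInterior ℝ F)
    (hy : y ∈ F) : ∃ w ∈ F, p ∈ openSegment ℝ y w := by
  obtain ⟨q, hq, rfl⟩ := mem_intrinsicInterior.1 hp
  let y' : affineSpan ℝ F := ⟨y, subset_affineSpan ℝ F hy⟩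
  have : Nonempty (affineSpan ℝ F) := ⟨y'⟩
  have hcont : Filter.Tendsto (AffineMap.lineMap y' q : ℝ → affineSpan ℝ F)
      (nhdsWithin 1 (Ioi 1)) (nhds q) :=
    (AffineMap.lineMap_continuous.tendsto' 1 q
      (AffineMap.lineMap_apply_one y' q)).mono_left nhdsWithin_le_nhds
  obtain ⟨t, ht, ht1⟩ := ((hcont.eventually (mem_interior_iff_mem_nhds.1 hq)).and
    self_mem_nhdsWithin).exists
  have ht1 : 1 < t := ht1
  refine ⟨_, ht, 1 - t⁻¹, t⁻¹, sub_pos.2 (inv_lt_one_of_one_lt₀ ht1), by positivity, by ring, ?_⟩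
  have hcoe : ((AffineMap.lineMap y' q t : affineSpan ℝ F) : V) = t • ((q : V) - y) + y := rfl
  rw [hcoe, smul_add, smul_smul, inv_mul_cancel₀ (by positivity)]
  module

/-- An extreme subset of `C` containing a relative interior point of `F ⊆ C` contains `F`. -/
theorem IsExtreme.subset_of_mem_intrinsicInterior (hG : IsExtreme ℝ C G) (hF : F ⊆ C)
    (hpF : p ∈ intrinsicInterior ℝ F) (hpG : p ∈ G) : F ⊆ G := by
  intro y hy
  obtain ⟨w, hw, hpw⟩ := exists_mem_openSegment_of_mem_intrinsicInterior hpF hy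
  exact hG.left_mem_of_mem_openSegment (hF hy) (hF hw) hpG hpw

end RelativeInterior

section Moreau

variable {E : Type*} [NormedAddCommGroup E] [InnerProductSpace ℝ E]

/-- The points of the polyhedral cone `{x | ∀ u ∈ U, ⟪u, x⟫ ≤ 0}` satisfying with equality every
constraint which is tight at `p`. -/
def tightFace (U : Finset E) (p : E) : Set E :=
  {y | (∀ u ∈ U, ⟪u, y⟫ ≤ 0) ∧ ∀ u ∈ U, ⟪u, p⟫ = 0 → ⟪u, y⟫ = 0}

theorem convex_tightFace (U : Finset E) (p : E) : Convex ℝ (tightFace U p) := by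
  rintro y ⟨hy, hy'⟩ z ⟨hz, hz'⟩ a b ha hb -
  refine ⟨fun u hu => ?_, fun u hu hup => ?_⟩ <;> rw [inner_add_right, inner_smul_right,
    inner_smul_right]
  · nlinarith [mul_nonneg ha (neg_nonneg.2 (hy u hu)), mul_nonneg hb (neg_nonneg.2 (hz u hu))]
  · rw [hy' u hu hup, hz' u hu hup]; ring

theorem isExtreme_tightFace (U : Finset E) (p : E) :
    IsExtreme ℝ {x : E | ∀ u ∈ U, ⟪u, x⟫ ≤ 0} (tightFace U p) := by
  refine ⟨fun y hy => hy.1, ?_⟩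
  rintro y hy z hz _ hw ⟨a, b, ha, hb, -, rfl⟩
  refine ⟨hy, fun u hu hup => le_antisymm (hy u hu) ?_⟩
  have h := hw.2 u hu hup
  rw [inner_add_right, inner_smul_right, inner_smul_right] at h
  nlinarith [mul_nonneg hb.le (neg_nonneg.2 (hz u hu)), hy u hu]

theorem mem_intrinsicInterior_tightFace {U : Finset E} {p : E} (hp : ∀ u ∈ U, ⟪u, p⟫ ≤ 0) :
    p ∈ intrinsicInterior ℝ (tightFace U p) := by
  have hpF : p ∈ tightFace U p := ⟨hp, fun _ _ h => h⟩
  refine mem_intrinsicInterior.2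
    ⟨⟨p, subset_affineSpan ℝ _ hpF⟩, mem_interior_iff_mem_nhds.2 ?_, rfl⟩
  have htight : ∀ y ∈ affineSpan ℝ (tightFace U p), ∀ u ∈ U, ⟪u, p⟫ = 0 → ⟪u, y⟫ = 0 := by
    intro y hy u hu hup
    have hle : affineSpan ℝ (tightFace U p) ≤ (LinearMap.ker (innerₛₗ ℝ u)).toAffineSubspace :=
      affineSpan_le.2 fun z hz => by simpa using hz.2 u hu hup
    simpa using hle hy
  have hslack : ∀ᶠ y in nhds p, ∀ u ∈ U, ⟪u, p⟫ < 0 → ⟪u, y⟫ < 0 := by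
    rw [Filter.eventually_all_finset]
    intro u _
    by_cases hup : ⟪u, p⟫ < 0
    · have hcont : Continuous fun y : E => ⟪u, y⟫ := by fun_prop
      filter_upwards [hcont.continuousAt.eventually (gt_mem_nhds hup)] with y hy _ using hy
    · simp [hup]
  filter_upwards [continuous_subtype_val.continuousAt.eventually hslack] with y hy
  refine ⟨fun u hu => ?_, htight y y.2⟩
  rcases (hp u hu).eq_or_lt with h | h
  · exact (htight y y.2 u hu h).le
  · exact (hy u hu h).le

/-- Moreau's decomposition of a point with respect to a complete convex cone. -/
theorem exists_moreau_decomposition {K : Set E} (h0 : (0 : E) ∈ K) (hK : Convex ℝ K)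
    (hcomplete : IsComplete K) (hcone : ∀ y ∈ K, ∀ r : ℝ, 0 < r → r • y ∈ K) (x : E) :
    ∃ p ∈ K, (∀ y ∈ K, ⟪x - p, y⟫ ≤ 0) ∧ ⟪x - p, p⟫ = 0 := by
  obtain ⟨p, hp, hmin⟩ := exists_norm_eq_iInf_of_complete_convex ⟨0, h0⟩ hcomplete hK x
  rw [norm_eq_iInf_iff_real_inner_le_zero hK hp] at hmin
  have hup : ⟪x - p, p⟫ = 0 := by
    have h1 := hmin 0 h0
    have h2 := hmin _ (hcone p hp 2 two_pos)
    simp only [inner_sub_right, inner_zero_right, inner_smul_right] at h1 h2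
    linarith
  refine ⟨p, hp, fun y hy => ?_, hup⟩
  simpa [inner_sub_right, hup] using hmin y hy

/-- The components of a Moreau decomposition are unique. -/
theorem eq_of_moreau_decomposition {p q u v : E} (h : p + u = q + v) (hup : ⟪u, p⟫ = 0)
    (hvq : ⟪v, q⟫ = 0) (huq : ⟪u, q⟫ ≤ 0) (hvp : ⟪v, p⟫ ≤ 0) : p = q := by
  have hpq : p - q = v - u := by rw [sub_eq_sub_iff_add_eq_add, h, add_comm]
  refine sub_eq_zero.1 (real_inner_self_nonpos.1 ?_)
  nth_rewrite 1 [hpq]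
  simp only [inner_sub_left, inner_sub_right]
  linarith

end Moreau

/-- Equation (3.1): for a polyhedral cone `C ⊆ ℝ^d`, every `x ∈ ℝ^d` lies in
`relint F + N(C,F)` for exactly one face `F` of `C`. -/
theorem moreau_decomposition_faces {d : ℕ} (C : Set (Euc d)) (hC : IsPolyCone C)
    (x : Euc d) :
    ∃! F : Set (Euc d), IsFace C F ∧ x ∈ intrinsicInterior ℝ F + normalCone C F := by
  obtain ⟨U, rfl⟩ := hC
  have hset : (⋂ u ∈ U, {x : Euc d | ⟪u, x⟫ ≤ 0}) = {x | ∀ u ∈ U, ⟪u, x⟫ ≤ 0} := by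
    ext; simp
  have hconvex : Convex ℝ (⋂ u ∈ U, {x : Euc d | ⟪u, x⟫ ≤ 0}) :=
    convex_iInter₂ fun u _ => convex_halfSpace_le (innerSL ℝ u).isLinear 0
  have hclosed : IsClosed (⋂ u ∈ U, {x : Euc d | ⟪u, x⟫ ≤ 0}) :=
    isClosed_biInter fun u _ => isClosed_le (by fun_prop) continuous_const
  rw [hset] at hconvex hclosed ⊢
  obtain ⟨p, hp, hpolar, hup⟩ := exists_moreau_decomposition (by simp) hconvex
    hclosed.isComplete (fun y hy r hr u hu => by
      rw [inner_smul_right]; exact mul_nonpos_of_nonneg_of_nonpos hr.le (hy u hu)) x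
  have hpF := mem_intrinsicInterior_tightFace hp
  have hE := isExtreme_tightFace U p
  refine ⟨tightFace U p, ⟨⟨hE, convex_tightFace U p, p, intrinsicInterior_subset hpF⟩,
    mem_add.2 ⟨p, hpF, x - p, ⟨hpolar, fun y hy => ?_⟩, add_sub_cancel p x⟩⟩, ?_⟩
  · obtain ⟨w, hw, a, b, ha, hb, -, hab⟩ :=
      exists_mem_openSegment_of_mem_intrinsicInterior hpF hy
    have hy0 := hpolar y (hE.subset hy)
    have hw0 := hpolar w (hE.subset hw)
    have h := congrArg (fun z => ⟪x - p, z⟫) hab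
    simp only [inner_add_right, inner_smul_right, hup] at h
    nlinarith [mul_nonneg hb.le (neg_nonneg.2 hw0)]
  · rintro G ⟨⟨hG, -, -⟩, hx⟩
    obtain ⟨q, hq, v, ⟨hv, hvG⟩, hqv⟩ := mem_add.1 hx
    have hqG := intrinsicInterior_subset hq
    obtain rfl : p = q := eq_of_moreau_decomposition (by rw [hqv, add_sub_cancel]) hup
      (hvG q hqG) (hpolar q (hG.subset hqG)) (hv p hp)
    exact (hE.subset_of_mem_intrinsicInterior hG.subset hq (intrinsicInterior_subset hpF)).antisymm
      (hG.subset_of_mem_intrinsicInterior hE.subset hpF hqG)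
end
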